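/- Let N = 4, a, b > 0, g : ℝ → ℝ, and suppose v ∈ C²(ℝ⁴) with V = ∫_{ℝ⁴}|∇v|² satisfying 0 < V < ∞ and −Δv = g(v) on ℝ⁴. Then there exists t > 0 such that u = v(t·) satisfies the Kirchhoff equation −(a + b∫_{ℝ⁴}|∇u|²)·Δu = g(u) on ℝ⁴ if and only if b·V < 1. -/

import Mathlib

open MeasureTheory

/-- The Laplacian of `u : ℝ^N → ℝ`, as the sum of second partial derivatives
along the standard basis directions. -/
noncomputable def lap {N : ℕ} (u : EuclideanSpace ℝ (Fin N) → ℝ)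
    (x : EuclideanSpace ℝ (Fin N)) : ℝ :=
  ∑ i : Fin N,
    fderiv ℝ (fun y => fderiv ℝ u y (EuclideanSpace.single i 1)) x (EuclideanSpace.single i 1)

/-- The Dirichlet energy `∫_{ℝ^N} |∇u|²`. -/
noncomputable def dirichlet {N : ℕ} (u : EuclideanSpace ℝ (Fin N) → ℝ) : ℝ :=
  ∫ x, ‖gradient u x‖ ^ 2

section Parametric

variable {H E : Type*} [NormedAddCommGroup H] [NormedSpace ℝ H] [ProperSpace H]
  [NormedAddCommGroup E] [MeasurableSpace E] [BorelSpace E]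
  {μ : Measure E} [IsFiniteMeasureOnCompacts μ]

/-- Differentiation under the integral sign against a compactly supported weight. -/
theorem hasFDerivAt_integral_mul_of_hasCompactSupport {ρ : E → ℝ} (hρ : Continuous ρ)
    (hρs : HasCompactSupport ρ) {G : H → E → ℝ} {G' : H → E → H →L[ℝ] ℝ}
    (hG : Continuous fun p : H × E => G p.1 p.2) (hG' : Continuous fun p : H × E => G' p.1 p.2)
    (hGG' : ∀ x y, HasFDerivAt (fun z => G z y) (G' x y) x) (x₀ : H) :
    HasFDerivAt (fun x => ∫ y, ρ y * G x y ∂μ) (∫ y, ρ y • G' x₀ y ∂μ) x₀ := by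
  obtain ⟨C, hC⟩ := ((isCompact_closedBall x₀ 1).prod hρs.isCompact).exists_bound_of_continuousOn
    hG'.continuousOn
  have hGc : ∀ x, Continuous fun y => ρ y * G x y := fun x =>
    hρ.mul (hG.comp (continuous_const.prodMk continuous_id))
  have hG'c : Continuous fun y => ρ y • G' x₀ y :=
    hρ.smul (hG'.comp (continuous_const.prodMk continuous_id))
  refine hasFDerivAt_integral_of_dominated_of_fderiv_le (bound := fun y => ‖ρ y‖ * C)
    (F' := fun x y => ρ y • G' x y) (Metric.closedBall_mem_nhds x₀ one_pos)
    (.of_forall fun x => (hGc x).aestronglyMeasurable)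
    ((hGc x₀).integrable_of_hasCompactSupport hρs.mul_right)
    (hG'c.integrable_of_hasCompactSupport hρs.smul_right).aestronglyMeasurable
    (.of_forall fun y x hx => ?_)
    ((hρ.integrable_of_hasCompactSupport hρs).norm.mul_const C)
    (.of_forall fun y x _ => (hGG' x y).const_mul (ρ y))
  rw [norm_smul]
  by_cases hy : y ∈ tsupport ρ
  · exact mul_le_mul_of_nonneg_left (hC (x, y) ⟨hx, hy⟩) (norm_nonneg _)
  · simp [image_eq_zero_of_notMem_tsupport hy]

end Parametric

section Tent

variable {E : Type*} [NormedAddCommGroup E]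

/-- The paraboloid tent `max (1 - ‖y‖²) 0`. -/
noncomputable def tent (y : E) : ℝ := max (1 - ‖y‖ ^ 2) 0

theorem continuous_tent : Continuous (tent : E → ℝ) := by
  unfold tent; fun_prop

theorem tent_nonneg (y : E) : 0 ≤ tent y := le_max_right _ _

theorem hasCompactSupport_tent [ProperSpace E] : HasCompactSupport (tent : E → ℝ) := by
  refine HasCompactSupport.intro (isCompact_closedBall (0 : E) 1) fun y hy => ?_
  have hy' : 1 < ‖y‖ := by simpa using hy
  exact max_eq_right (by nlinarith)

theorem hasDerivAt_max_zero_sq (s : ℝ) :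
    HasDerivAt (fun r : ℝ => max r 0 ^ 2) (2 * max s 0) s := by
  rcases lt_trichotomy s 0 with hs | rfl | hs
  · have h : (fun r : ℝ => max r 0 ^ 2) =ᶠ[nhds s] fun _ => 0 := by
      filter_upwards [gt_mem_nhds hs] with r hr
      simp [max_eq_right hr.le]
    simpa [max_eq_right hs.le] using (hasDerivAt_const s (0 : ℝ)).congr_of_eventuallyEq h
  · rw [hasDerivAt_iff_isLittleO_nhds_zero]
    have h : (fun r : ℝ => r ^ 2) =o[nhds 0] fun r => r := by
      simpa using Asymptotics.isLittleO_pow_id (𝕜 := ℝ) (n := 2) (by norm_num)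
    refine (Asymptotics.IsBigO.of_norm_le fun r => ?_).trans_isLittleO h
    rcases le_total r 0 with hr | hr <;> simp [hr, sq_nonneg]
  · have h : (fun r : ℝ => max r 0 ^ 2) =ᶠ[nhds s] fun r => r ^ 2 := by
      filter_upwards [lt_mem_nhds hs] with r hr
      simp [max_eq_left hr.le]
    simpa [max_eq_left hs.le] using (hasDerivAt_pow 2 s).congr_of_eventuallyEq h

theorem hasFDerivAt_tent_sq {E : Type*} [NormedAddCommGroup E] [InnerProductSpace ℝ E] (y : E) :
    HasFDerivAt (fun z : E => tent z ^ 2) ((-4 * tent y) • innerSL ℝ y) y := by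
  have h := (hasDerivAt_max_zero_sq (1 - ‖y‖ ^ 2)).comp_hasFDerivAt y
    ((hasStrictFDerivAt_norm_sq y).hasFDerivAt.const_sub 1)
  refine h.congr_fderiv ?_
  ext z
  simp [tent]
  ring

end Tent

section Harmonic

variable {N : ℕ} {v : EuclideanSpace ℝ (Fin N) → ℝ}

theorem integral_tent_mul_fderiv_eq_zero (hv : ContDiff ℝ 2 v) (hlap : ∀ x, lap v x = 0)
    (x : EuclideanSpace ℝ (Fin N)) (R : ℝ) :
    ∫ y, tent y * fderiv ℝ v (x + R • y) y = 0 := by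
  let e : Fin N → EuclideanSpace ℝ (Fin N) := fun i => EuclideanSpace.single i 1
  let w : Fin N → EuclideanSpace ℝ (Fin N) → ℝ := fun i y => fderiv ℝ v y (e i)
  have hw : ∀ i, ContDiff ℝ 1 (w i) := fun i =>
    (hv.fderiv_right (m := 1) (by norm_num)).clm_apply contDiff_const
  have hwR : ∀ i y, HasFDerivAt (fun y => w i (x + R • y)) (R • fderiv ℝ (w i) (x + R • y)) y := by
    intro i y
    have h := (((hw i).differentiable one_ne_zero) (x + R • y)).hasFDerivAt.comp y
      (((hasFDerivAt_id y).const_smul R).const_add x)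
    refine h.congr_fderiv ?_
    ext z
    simp
  have hwc : ∀ i, Continuous fun y => w i (x + R • y) := fun i =>
    (hw i).continuous.comp (by fun_prop)
  have hw'c : ∀ i, Continuous fun y => fderiv ℝ (w i) (x + R • y) (e i) := fun i =>
    (((hw i).continuous_fderiv one_ne_zero).comp (by fun_prop)).clm_apply continuous_const
  have hts : HasCompactSupport (fun y : EuclideanSpace ℝ (Fin N) => tent y ^ 2) :=
    hasCompactSupport_tent.comp_left (g := fun r : ℝ => r ^ 2) (by simp)
  have htc : Continuous (fun y : EuclideanSpace ℝ (Fin N) => tent y ^ 2) := continuous_tent.pow 2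
  have hdt : ∀ i (y : EuclideanSpace ℝ (Fin N)),
      fderiv ℝ (fun z => tent z ^ 2) y (e i) = -4 * (tent y * y i) := by
    intro i y
    rw [(hasFDerivAt_tent_sq y).fderiv]
    simp [e, EuclideanSpace.inner_single_right]
    ring
  have htyc : ∀ i, Continuous fun y : EuclideanSpace ℝ (Fin N) => tent y * y i := fun i =>
    continuous_tent.mul (by fun_prop)
  have hty : ∀ i, Integrable fun y => tent y * y i * w i (x + R • y) := fun i =>
    ((htyc i).mul (hwc i)).integrable_of_hasCompactSupport
      (hasCompactSupport_tent.mul_right.mul_right)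
  have htw' : ∀ i, Integrable fun y => tent y ^ 2 * (R * fderiv ℝ (w i) (x + R • y) (e i)) :=
    fun i => (htc.mul (continuous_const.mul (hw'c i))).integrable_of_hasCompactSupport
      hts.mul_right
  have hibp : ∀ i, ∫ y, tent y ^ 2 * (R * fderiv ℝ (w i) (x + R • y) (e i)) =
      4 * ∫ y, tent y * y i * w i (x + R • y) := by
    intro i
    have h := integral_mul_fderiv_eq_neg_fderiv_mul_of_integrable (μ := volume)
      (f := fun y : EuclideanSpace ℝ (Fin N) => tent y ^ 2) (g := fun y => w i (x + R • y))
      (v := e i) (by simpa only [hdt, mul_assoc] using ((hty i).const_mul (-4)))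
      (by simpa only [(hwR i _).fderiv, smul_apply, smul_eq_mul] using htw' i)
      ((htc.mul (hwc i)).integrable_of_hasCompactSupport hts.mul_right)
      (fun y _ => (hasFDerivAt_tent_sq y).differentiableAt)
      (fun y _ => (hwR i y).differentiableAt)
    simp only [(hwR i _).fderiv, hdt, smul_apply, smul_eq_mul] at h
    rw [h, ← integral_const_mul, ← integral_neg]
    congr with y
    ring
  have hexp : ∀ y, tent y * fderiv ℝ v (x + R • y) y =
      ∑ i, tent y * y i * w i (x + R • y) := by
    intro y
    have hy : y = ∑ i, y i • e i := by
      simpa [e] using ((EuclideanSpace.basisFun (Fin N) ℝ).sum_repr y).symm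
    have h := congrArg (fderiv ℝ v (x + R • y)) hy
    simp only [map_sum, map_smul, smul_eq_mul] at h
    rw [h, Finset.mul_sum]
    simp only [w, mul_assoc]
  have hzero : 4 * ∫ y, tent y * fderiv ℝ v (x + R • y) y = 0 := by
    simp_rw [hexp]
    rw [integral_finsetSum _ fun i _ => hty i, Finset.mul_sum]
    simp_rw [← hibp]
    rw [← integral_finsetSum _ fun i _ => htw' i]
    simp_rw [← Finset.mul_sum]
    have : ∀ y, ∑ i, fderiv ℝ (w i) (x + R • y) (e i) = 0 := fun y => hlap (x + R • y)
    simp [this]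
  linarith

/-- The mean value property of harmonic functions, averaged against `tent`. -/
theorem integral_tent_mul_comp_eq (hv : ContDiff ℝ 2 v) (hlap : ∀ x, lap v x = 0)
    (x : EuclideanSpace ℝ (Fin N)) (R : ℝ) :
    ∫ y, tent y * v (x + R • y) = (∫ y : EuclideanSpace ℝ (Fin N), tent y) * v x := by
  have hv' : Continuous (fderiv ℝ v) := hv.continuous_fderiv two_ne_zero
  have hc : ∀ r : ℝ, HasFDerivAt (fun r : ℝ => ∫ y, tent y * v (x + r • y)) (0 : ℝ →L[ℝ] ℝ) r := by
    intro r
    have h := hasFDerivAt_integral_mul_of_hasCompactSupport (μ := volume) continuous_tent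
      hasCompactSupport_tent (G := fun (r : ℝ) y => v (x + r • y))
      (G' := fun r y => (fderiv ℝ v (x + r • y)).comp (ContinuousLinearMap.toSpanSingleton ℝ y))
      (hv.continuous.comp (by fun_prop))
      ((hv'.comp (by fun_prop)).clm_comp
        ((ContinuousLinearMap.toSpanSingletonCLE (𝕜 := ℝ)
          (E := EuclideanSpace ℝ (Fin N))).continuous.comp continuous_snd))
      (fun r y => (hv.differentiable two_ne_zero (x + r • y)).hasFDerivAt.comp r
        (((ContinuousLinearMap.toSpanSingleton ℝ y).hasFDerivAt).const_add x)) r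
    refine h.congr_fderiv ?_
    ext
    rw [ContinuousLinearMap.integral_apply]
    · simpa using integral_tent_mul_fderiv_eq_zero hv hlap x r
    · refine Continuous.integrable_of_hasCompactSupport (continuous_tent.smul
        ((hv'.comp (by fun_prop)).clm_comp
        ((ContinuousLinearMap.toSpanSingletonCLE (𝕜 := ℝ)
          (E := EuclideanSpace ℝ (Fin N))).continuous))) hasCompactSupport_tent.smul_right
  have h := is_const_of_fderiv_eq_zero (fun r => (hc r).differentiableAt)
    (fun r => (hc r).fderiv) R 0
  simpa [integral_mul_const] using h

theorem integral_tent_smul_fderiv_comp_eq (hv : ContDiff ℝ 2 v) (hlap : ∀ x, lap v x = 0)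
    (x : EuclideanSpace ℝ (Fin N)) (R : ℝ) :
    ∫ y, tent y • fderiv ℝ v (x + R • y) =
      (∫ y : EuclideanSpace ℝ (Fin N), tent y) • fderiv ℝ v x := by
  have hv' : Continuous (fderiv ℝ v) := hv.continuous_fderiv two_ne_zero
  have h := hasFDerivAt_integral_mul_of_hasCompactSupport (μ := volume) continuous_tent
    hasCompactSupport_tent (G := fun x y => v (x + R • y))
    (G' := fun x y => fderiv ℝ v (x + R • y))
    (hv.continuous.comp (by fun_prop)) (hv'.comp (by fun_prop))
    (fun x y => (hv.differentiable two_ne_zero (x + R • y)).hasFDerivAt.comp x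
        ((hasFDerivAt_id x).add_const (R • y))) x
  simp_rw [integral_tent_mul_comp_eq hv hlap] at h
  exact h.unique (((hv.differentiable two_ne_zero x).hasFDerivAt).const_mul _)

theorem norm_gradient (x : EuclideanSpace ℝ (Fin N)) : ‖gradient v x‖ = ‖fderiv ℝ v x‖ := by
  simp [gradient]

/-- A harmonic function of finite Dirichlet energy has vanishing derivative. -/
theorem fderiv_eq_zero_of_lap_eq_zero [NeZero N] (hv : ContDiff ℝ 2 v) (hlap : ∀ x, lap v x = 0)
    (hint : Integrable fun x => ‖fderiv ℝ v x‖ ^ 2) (x : EuclideanSpace ℝ (Fin N)) :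
    fderiv ℝ v x = 0 := by
  have hv' : Continuous (fderiv ℝ v) := hv.continuous_fderiv two_ne_zero
  set c := ∫ y : EuclideanSpace ℝ (Fin N), tent y
  set K := ∫ y : EuclideanSpace ℝ (Fin N), tent y ^ 2
  set V := ∫ y, ‖fderiv ℝ v y‖ ^ 2
  have hc : 0 < c := continuous_tent.integral_pos_of_hasCompactSupport_nonneg_nonzero
    hasCompactSupport_tent tent_nonneg (x := 0) (by simp [tent])
  have hts : HasCompactSupport (fun y : EuclideanSpace ℝ (Fin N) => tent y ^ 2) :=
    hasCompactSupport_tent.comp_left (g := fun r : ℝ => r ^ 2) (by simp)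
  have hK : Integrable (fun y : EuclideanSpace ℝ (Fin N) => tent y ^ 2) :=
    (continuous_tent.pow 2).integrable_of_hasCompactSupport hts
  have hbound : ∀ s : ℝ, 0 < s → c * ‖fderiv ℝ v x‖ ≤ (K + V) / 2 * (s ^ N)⁻¹ := by
    intro s hs
    have hx : Integrable fun y => ‖fderiv ℝ v (x + s ^ 2 • y)‖ ^ 2 :=
      (hint.comp_add_left x).comp_smul (pow_ne_zero 2 hs.ne')
    have hxV : ∫ y, ‖fderiv ℝ v (x + s ^ 2 • y)‖ ^ 2 = ((s ^ N) ^ 2)⁻¹ * V := by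
      have h := Measure.integral_comp_smul (volume : Measure (EuclideanSpace ℝ (Fin N)))
        (fun y => ‖fderiv ℝ v (x + y)‖ ^ 2) (s ^ 2)
      rw [h, integral_add_left_eq_self (fun y => ‖fderiv ℝ v y‖ ^ 2) x, finrank_euclideanSpace,
        Fintype.card_fin, abs_of_pos (by positivity), smul_eq_mul, ← pow_mul, ← pow_mul,
        mul_comm 2 N]
    calc c * ‖fderiv ℝ v x‖ = ‖∫ y, tent y • fderiv ℝ v (x + s ^ 2 • y)‖ := by
          rw [integral_tent_smul_fderiv_comp_eq hv hlap, norm_smul, Real.norm_of_nonneg hc.le]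
      _ ≤ ∫ y, ((s ^ N)⁻¹ / 2 * tent y ^ 2
            + s ^ N / 2 * ‖fderiv ℝ v (x + s ^ 2 • y)‖ ^ 2) := by
          refine norm_integral_le_of_norm_le ((hK.const_mul _).add (hx.const_mul _))
            (.of_forall fun y => ?_)
          rw [norm_smul, Real.norm_of_nonneg (tent_nonneg y)]
          have hp : 0 < s ^ N := by positivity
          have h := mul_nonneg (inv_nonneg.2 hp.le)
            (sq_nonneg (tent y - s ^ N * ‖fderiv ℝ v (x + s ^ 2 • y)‖))
          have h' : (s ^ N)⁻¹ * (tent y - s ^ N * ‖fderiv ℝ v (x + s ^ 2 • y)‖) ^ 2 =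
              (s ^ N)⁻¹ * tent y ^ 2 - 2 * (tent y * ‖fderiv ℝ v (x + s ^ 2 • y)‖)
                + s ^ N * ‖fderiv ℝ v (x + s ^ 2 • y)‖ ^ 2 := by
            field_simp
            ring
          linarith
      _ = (K + V) / 2 * (s ^ N)⁻¹ := by
          rw [integral_add (hK.const_mul _) (hx.const_mul _), integral_const_mul,
            integral_const_mul, hxV]
          change (s ^ N)⁻¹ / 2 * K + _ = _
          field_simp
  have hlim : Filter.Tendsto (fun s : ℝ => (K + V) / 2 * (s ^ N)⁻¹) Filter.atTop (nhds 0) := by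
    simpa using ((Filter.tendsto_pow_atTop (α := ℝ) (NeZero.ne N)).inv_tendsto_atTop).const_mul
      ((K + V) / 2)
  have h0 : c * ‖fderiv ℝ v x‖ ≤ 0 := ge_of_tendsto hlim
    ((Filter.eventually_gt_atTop 0).mono hbound)
  exact norm_le_zero_iff.1 (nonpos_of_mul_nonpos_right h0 hc)

theorem lap_comp_smul (t : ℝ) (x : EuclideanSpace ℝ (Fin N)) :
    lap (fun y => v (t • y)) x = t ^ 2 * lap v (t • x) := by
  unfold lap
  rw [Finset.mul_sum]
  refine Finset.sum_congr rfl fun i _ => ?_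
  simp only [fderiv_comp_smul, smul_apply]
  have h := fderiv_comp_smul (𝕜 := ℝ) (f := fun y => fderiv ℝ v y (EuclideanSpace.single i 1))
    (x := x) t
  have hs := congrFun (fderiv_const_smul_field (𝕜 := ℝ) t
    (f := fun y => fderiv ℝ v (t • y) (EuclideanSpace.single i 1))) x
  simp only [Pi.smul_def] at hs
  rw [hs, h]
  simp only [smul_apply, smul_eq_mul]
  ring

theorem dirichlet_comp_smul {v : EuclideanSpace ℝ (Fin 4) → ℝ} {t : ℝ} (ht : 0 < t) :
    dirichlet (fun y => v (t • y)) = (t ^ 2)⁻¹ * dirichlet v := by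
  unfold dirichlet
  simp only [norm_gradient, fderiv_comp_smul, norm_smul, mul_pow]
  rw [integral_const_mul, Measure.integral_comp_smul volume (fun y => ‖fderiv ℝ v y‖ ^ 2) t,
    finrank_euclideanSpace, Fintype.card_fin, abs_of_pos (by positivity), smul_eq_mul,
    Real.norm_of_nonneg ht.le]
  field_simp

end Harmonic

theorem stmt11 (a b : ℝ) (ha : 0 < a) (hb : 0 < b) (g : ℝ → ℝ)
    (v : EuclideanSpace ℝ (Fin 4) → ℝ)
    (hv : ContDiff ℝ 2 v)
    (V : ℝ) (hV : V = dirichlet v) (hVpos : 0 < V)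
    (hvInt : Integrable (fun x => ‖gradient v x‖ ^ 2))
    (hvEq : ∀ x, -lap v x = g (v x)) :
    (∃ t : ℝ, 0 < t ∧
      ∀ x, -((a + b * dirichlet (fun y => v (t • y))) * lap (fun y => v (t • y)) x)
          = g (v (t • x))) ↔ b * V < 1 := by
  have key : ∀ t : ℝ, 0 < t → ∀ x,
      (a + b * dirichlet (fun y => v (t • y))) * lap (fun y => v (t • y)) x =
        (a * t ^ 2 + b * V) * lap v (t • x) := by
    intro t ht x
    rw [dirichlet_comp_smul ht, lap_comp_smul, hV]
    field_simp
  constructor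
  · rintro ⟨t, ht, h⟩
    obtain ⟨z, hz⟩ : ∃ z, lap v z ≠ 0 := by
      by_contra! hlap
      have h0 := fderiv_eq_zero_of_lap_eq_zero hv hlap (by simpa only [norm_gradient] using hvInt)
      simp [hV, dirichlet, norm_gradient, h0] at hVpos
    have hz' := h (t⁻¹ • z)
    rw [key t ht, smul_inv_smul₀ ht.ne', ← hvEq, neg_inj] at hz'
    have hone : a * t ^ 2 + b * V = 1 := mul_right_cancel₀ hz (by rw [hz', one_mul])
    linarith [mul_pos ha (pow_pos ht 2)]
  · intro h
    have hpos : 0 < (1 - b * V) / a := div_pos (by linarith) ha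
    refine ⟨√((1 - b * V) / a), Real.sqrt_pos.2 hpos, fun x => ?_⟩
    rw [key _ (Real.sqrt_pos.2 hpos), ← hvEq, Real.sq_sqrt hpos.le, mul_div_cancel₀ _ ha.ne']
    ring
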